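/- Let dA ≥ 2, dB ≥ 2, and let Φ be a CPTP map on (dA·dB)×(dA·dB) complex matrices such that Φ(ρ) is classical-quantum with respect to subsystem A for every state ρ on ℂ^{dA} ⊗ ℂ^{dB} (i.e., Φ is discord-annihilating). Then Φ, viewed as a ℂ-linear endomorphism of the space of (dA·dB)×(dA·dB) matrices, has determinant zero; equivalently, Φ is not injective. (Proposition 1: discord-annihilating channels have vanishing determinant.) -/

import Mathlib

open Matrix
open scoped Kronecker ComplexOrder

noncomputable section

/-- A state: positive semidefinite matrix with unit trace. -/
def IsState {ι : Type} [Fintype ι] (ρ : Matrix ι ι ℂ) : Prop :=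
  ρ.PosSemidef ∧ ρ.trace = 1

/-- The rank-one matrix `|ψ⟩⟨ψ| = ψ ψ†`. -/
def outer {d : ℕ} (ψ : Fin d → ℂ) : Matrix (Fin d) (Fin d) ℂ :=
  Matrix.of fun i j => ψ i * star (ψ j)

/-- A bipartite state (on `ℂ^{dA} ⊗ ℂ^{dB}`, Kronecker-product convention) is
classical-quantum with respect to subsystem `A` if it is a convex combination
`∑ k, p k • |ψ k⟩⟨ψ k| ⊗ σB k` with `{ψ k}` orthonormal in `ℂ^{dA}` and `σB k` states. -/
def IsCQ {dA dB : ℕ} (ρ : Matrix (Fin dA × Fin dB) (Fin dA × Fin dB) ℂ) : Prop :=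
  ∃ (n : ℕ) (ψ : Fin n → Fin dA → ℂ) (p : Fin n → ℝ)
    (σB : Fin n → Matrix (Fin dB) (Fin dB) ℂ),
      (∀ k l, star (ψ k) ⬝ᵥ ψ l = if k = l then 1 else 0) ∧
      (∀ k, 0 ≤ p k) ∧ (∑ k, p k = 1) ∧ (∀ k, IsState (σB k)) ∧
      ρ = ∑ k, (p k : ℂ) • (outer (ψ k) ⊗ₖ σB k)

/-- The `(a,b)` block (a matrix on the second factor) of a matrix on `Fin m × ι`. -/
def blockA {m : ℕ} {ι : Type} (a b : Fin m) :
    Matrix (Fin m × ι) (Fin m × ι) ℂ →ₗ[ℂ] Matrix ι ι ℂ where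
  toFun M := Matrix.of fun i j => M (a, i) (b, j)
  map_add' _ _ := rfl
  map_smul' _ _ := rfl

/-- The `(i,j)` slice (a matrix on the first factor) of a matrix on `Fin m × Fin d`. -/
def blockB {m d : ℕ} (i j : Fin d) :
    Matrix (Fin m × Fin d) (Fin m × Fin d) ℂ →ₗ[ℂ] Matrix (Fin m) (Fin m) ℂ where
  toFun M := Matrix.of fun a b => M (a, i) (b, j)
  map_add' _ _ := rfl
  map_smul' _ _ := rfl

/-- `id_m ⊗ Φ`: the extension of `Φ` (acting on the second factor) by the identity
on the first factor.  On Kronecker products, `(id_m ⊗ Φ)(Y ⊗ₖ X) = Y ⊗ₖ Φ X`. -/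
def idTensor {ι : Type} (m : ℕ) (Φ : Matrix ι ι ℂ →ₗ[ℂ] Matrix ι ι ℂ) :
    Matrix (Fin m × ι) (Fin m × ι) ℂ →ₗ[ℂ] Matrix (Fin m × ι) (Fin m × ι) ℂ where
  toFun M := Matrix.of fun p q => Φ (blockA p.1 q.1 M) p.2 q.2
  map_add' M N := by
    ext ⟨a, i⟩ ⟨b, j⟩
    simp [Matrix.add_apply]
  map_smul' c M := by
    ext ⟨a, i⟩ ⟨b, j⟩
    simp [Matrix.smul_apply]

/-- `Φ ⊗ id_m`: the extension of `Φ` (acting on the first factor) by the identity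
on the second factor.  On Kronecker products, `(Φ ⊗ id_m)(X ⊗ₖ Y) = Φ X ⊗ₖ Y`. -/
def tensorId {d : ℕ} (Φ : Matrix (Fin d) (Fin d) ℂ →ₗ[ℂ] Matrix (Fin d) (Fin d) ℂ)
    (m : ℕ) :
    Matrix (Fin d × Fin m) (Fin d × Fin m) ℂ →ₗ[ℂ]
      Matrix (Fin d × Fin m) (Fin d × Fin m) ℂ where
  toFun M := Matrix.of fun p q => Φ (blockB p.2 q.2 M) p.1 q.1
  map_add' M N := by
    ext ⟨a, i⟩ ⟨b, j⟩
    simp [Matrix.add_apply]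
  map_smul' c M := by
    ext ⟨a, i⟩ ⟨b, j⟩
    simp [Matrix.smul_apply]

/-- CPTP: trace preserving and completely positive (every extension `id_k ⊗ Φ`
maps positive semidefinite matrices to positive semidefinite matrices). -/
def IsCPTP {ι : Type} [Fintype ι] (Φ : Matrix ι ι ℂ →ₗ[ℂ] Matrix ι ι ℂ) : Prop :=
  (∀ X, (Φ X).trace = X.trace) ∧
  ∀ k : ℕ, ∀ M : Matrix (Fin k × ι) (Fin k × ι) ℂ,
    M.PosSemidef → (idTensor k Φ M).PosSemidef

/-- Partial trace over the second (B) factor: `tr_B(X ⊗ₖ Y) = tr(Y) • X`. -/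
def ptraceB {dA dB : ℕ} (M : Matrix (Fin dA × Fin dB) (Fin dA × Fin dB) ℂ) :
    Matrix (Fin dA) (Fin dA) ℂ :=
  Matrix.of fun a b => ∑ i, M (a, i) (b, i)

/-- The point channel with fixed state `σ`: `X ↦ tr(X) • σ`. -/
def pointChannel {d : ℕ} (σ : Matrix (Fin d) (Fin d) ℂ) :
    Matrix (Fin d) (Fin d) ℂ →ₗ[ℂ] Matrix (Fin d) (Fin d) ℂ where
  toFun X := X.trace • σ
  map_add' X Y := by simp [Matrix.trace_add, add_smul]
  map_smul' c X := by simp [Matrix.trace_smul, smul_smul]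

/-- A quantum-classical channel: `Φ(X) = ∑ k, tr(F k * X) • |ψ k⟩⟨ψ k|` for an
orthonormal family `{ψ k}` and a POVM `{F k}`. -/
def IsQCChannel {d : ℕ} (Φ : Matrix (Fin d) (Fin d) ℂ →ₗ[ℂ] Matrix (Fin d) (Fin d) ℂ) :
    Prop :=
  ∃ (n : ℕ) (ψ : Fin n → Fin d → ℂ) (F : Fin n → Matrix (Fin d) (Fin d) ℂ),
    (∀ k l, star (ψ k) ⬝ᵥ ψ l = if k = l then 1 else 0) ∧
    (∀ k, (F k).PosSemidef) ∧ (∑ k, F k = 1) ∧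
    (∀ X, Φ X = ∑ k, (F k * X).trace • outer (ψ k))

@[simp]
lemma blockB_apply {m d : ℕ} (i j : Fin d) (M : Matrix (Fin m × Fin d) (Fin m × Fin d) ℂ)
    (a b : Fin m) : blockB i j M a b = M (a, i) (b, j) := rfl

/-- The positive semidefinite matrices span all matrices. -/
lemma span_posSemidef {ι : Type} [Fintype ι] [DecidableEq ι] :
    Submodule.span ℂ {X : Matrix ι ι ℂ | X.PosSemidef} = ⊤ := by
  open scoped Matrix.Norms.L2Operator MatrixOrder in
  have h := CStarAlgebra.span_nonneg (A := Matrix ι ι ℂ)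
  simpa only [Matrix.nonneg_iff_posSemidef] using h

/-- A bilinear map on matrices that vanishes on the diagonal at all states is alternating. -/
lemma apply_self_eq_zero_of_isState {ι : Type} [Fintype ι] [DecidableEq ι]
    {N : Type*} [AddCommGroup N] [Module ℂ N]
    (Q : Matrix ι ι ℂ →ₗ[ℂ] Matrix ι ι ℂ →ₗ[ℂ] N)
    (hQ : ∀ ρ, IsState ρ → Q ρ ρ = 0) (X : Matrix ι ι ℂ) : Q X X = 0 := by
  have hpos : ∀ P : Matrix ι ι ℂ, P.PosSemidef → Q P P = 0 := by
    intro P hP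
    by_cases ht : P.trace = 0
    · simp [hP.trace_eq_zero_iff.mp ht]
    · have hs : IsState (P.trace⁻¹ • P) :=
        ⟨hP.smul (inv_nonneg.mpr hP.trace_nonneg), by simp [Matrix.trace_smul, ht]⟩
      simpa [ht] using hQ _ hs
  have hsymm : Q + Q.flip = 0 := by
    refine LinearMap.ext_on span_posSemidef fun P hP =>
      LinearMap.ext_on span_posSemidef fun R hR => ?_
    have h := hpos (P + R) (hP.add hR)
    simpa [hpos P hP, hpos R hR] using h
  have h := LinearMap.congr_fun₂ hsymm X X
  simpa [← two_smul ℂ] using h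

lemma outer_mul_outer {d : ℕ} (φ ψ : Fin d → ℂ) :
    outer φ * outer ψ = (star φ ⬝ᵥ ψ) • Matrix.of fun i j => φ i * star (ψ j) := by
  ext i j
  simp only [outer, Matrix.mul_apply, Matrix.of_apply, Matrix.smul_apply, dotProduct, smul_eq_mul,
    Pi.star_apply, Finset.sum_mul]
  exact Finset.sum_congr rfl fun _ _ => by ring

lemma commute_outer {d n : ℕ} {ψ : Fin n → Fin d → ℂ}
    (hψ : ∀ k l, star (ψ k) ⬝ᵥ ψ l = if k = l then 1 else 0) (k l : Fin n) :
    Commute (outer (ψ k)) (outer (ψ l)) := by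
  by_cases h : k = l
  · rw [h]
  · simp [Commute, SemiconjBy, outer_mul_outer, hψ, h, Ne.symm h]

/-- The slices on the first factor of a classical-quantum state commute pairwise. -/
lemma IsCQ.commute_blockB {dA dB : ℕ} {ρ : Matrix (Fin dA × Fin dB) (Fin dA × Fin dB) ℂ}
    (hρ : IsCQ ρ) (i j k l : Fin dB) : Commute (blockB i j ρ) (blockB k l ρ) := by
  obtain ⟨n, ψ, p, σ, hψ, -, -, -, rfl⟩ := hρ
  have hblock : ∀ i j : Fin dB, blockB i j (∑ k, (p k : ℂ) • (outer (ψ k) ⊗ₖ σ k)) =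
      ∑ k, ((p k : ℂ) * σ k i j) • outer (ψ k) := by
    intro i j
    rw [map_sum]
    refine Finset.sum_congr rfl fun k _ => ?_
    ext a b
    simp only [blockB_apply, Matrix.smul_apply, Matrix.kroneckerMap_apply, smul_eq_mul]
    ring
  rw [hblock, hblock]
  exact Commute.sum_left _ _ _ fun a _ => Commute.sum_right _ _ _ fun b _ =>
    ((commute_outer hψ a b).smul_left _).smul_right _

/-- Proposition 1: discord-annihilating channels have vanishing
determinant; equivalently, they are not injective. -/
theorem stmt_13 (dA dB : ℕ) (hdA : 2 ≤ dA) (hdB : 2 ≤ dB)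
    (Φ : Matrix (Fin dA × Fin dB) (Fin dA × Fin dB) ℂ →ₗ[ℂ]
      Matrix (Fin dA × Fin dB) (Fin dA × Fin dB) ℂ)
    (hΦ : IsCPTP Φ)
    (hDA : ∀ ρ : Matrix (Fin dA × Fin dB) (Fin dA × Fin dB) ℂ, IsState ρ →
      IsCQ (Φ ρ)) :
    LinearMap.det Φ = 0 ∧ ¬ Function.Injective Φ := by
  have hinj : ¬ Function.Injective Φ := by
    intro hinj
    obtain ⟨a, b, hab⟩ : ∃ a b : Fin dA, a ≠ b := ⟨⟨0, by omega⟩, ⟨1, by omega⟩, by simp⟩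
    obtain ⟨i, j, hij⟩ : ∃ i j : Fin dB, i ≠ j := ⟨⟨0, by omega⟩, ⟨1, by omega⟩, by simp⟩
    let F := blockB i i ∘ₗ Φ
    let G := blockB j j ∘ₗ Φ
    let L := LinearMap.mul ℂ (Matrix (Fin dA) (Fin dA) ℂ)
    obtain ⟨X, hX⟩ := LinearMap.injective_iff_surjective.mp hinj
      (Matrix.single (a, i) (b, i) 1 + Matrix.single (b, j) (a, j) 1)
    have hcomm := apply_self_eq_zero_of_isState (L.compl₁₂ F G - L.flip.compl₁₂ F G)
      (fun ρ hρ => by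
        simpa [L, F, G, sub_eq_zero] using ((hDA ρ hρ).commute_blockB i i j j).eq) X
    have hF : F X = Matrix.single a b 1 := by
      ext x y
      simp [F, hX, Matrix.single_apply, hij.symm]
    have hG : G X = Matrix.single b a 1 := by
      ext x y
      simp [G, hX, Matrix.single_apply, hij]
    have h := congrFun (congrFun hcomm a) a
    simp [L, hF, hG, hab.symm] at h
  refine ⟨?_, hinj⟩
  by_contra hdet
  exact hinj ((Module.End.isUnit_iff _).mp
    ((LinearMap.isUnit_iff_isUnit_det Φ).mpr (isUnit_iff_ne_zero.mpr hdet))).injective
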